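/- If φ is a non-growing morphism prolongable on a and the factors of α = φ^∞(a) consisting only of bounded letters have bounded length, then there exist a finite alphabet Σ, a growing morphism σ : Σ* → Σ*, a letter b ∈ Σ on which σ is prolongable, and a non-erasing morphism ψ : Σ* → A* such that α = ψ(σ^∞(b)); moreover P_α(n) = Θ(P_{σ^∞(b)}(n)), so α and σ^∞(b) are in the same complexity class. -/

import Mathlib

open Filter Asymptotics

variable {A : Type*}

/-- Extension of a morphism, given on letters, to words. -/
def wordMap (φ : A → List A) (w : List A) : List A := w.flatMap φ

/-- The factor of the infinite word α of length n starting at position i. -/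
def factorAt (α : ℕ → A) (i n : ℕ) : List A := (List.range n).map (fun j => α (i + j))

/-- w is a factor (contiguous subword) of the infinite word α. -/
def IsFactor (α : ℕ → A) (w : List A) : Prop := ∃ i, w = factorAt α i w.length

/-- The factor complexity of α: the number of distinct factors of length n. -/
noncomputable def complexity (α : ℕ → A) (n : ℕ) : ℕ :=
  Set.ncard {w : List A | w.length = n ∧ IsFactor α w}

def UltimatelyPeriodic (α : ℕ → A) : Prop :=
  ∃ N p : ℕ, 1 ≤ p ∧ ∀ i, N ≤ i → α (i + p) = α i

/-- φ is prolongable on a: φ(a) = a·w with w nonempty and |φ^n(a)| → ∞. -/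
def Prolongable (φ : A → List A) (a : A) : Prop :=
  (∃ w, w ≠ [] ∧ φ a = a :: w) ∧
    Tendsto (fun n => ((wordMap φ)^[n] [a]).length) atTop atTop

/-- α is the pure morphic sequence φ^∞(a): every iterate φ^n(a) is a prefix of α. -/
def IsFixedSeq (φ : A → List A) (a : A) (α : ℕ → A) : Prop :=
  ∀ n, factorAt α 0 ((wordMap φ)^[n] [a]).length = (wordMap φ)^[n] [a]

/-- The letter b is growing for φ: |φ^k(b)| → ∞. -/
def GrowingLetter (φ : A → List A) (b : A) : Prop :=
  Tendsto (fun k => ((wordMap φ)^[k] [b]).length) atTop atTop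

def BoundedLetter (φ : A → List A) (b : A) : Prop := ¬ GrowingLetter φ b

/-- φ is growing: every letter is growing. -/
def Growing (φ : A → List A) : Prop := ∀ b, GrowingLetter φ b

/-- The factors of α consisting only of bounded letters have bounded length. -/
def BFactorsBounded (φ : A → List A) (α : ℕ → A) : Prop :=
  ∃ C, ∀ w : List A, IsFactor α w → (∀ b ∈ w, BoundedLetter φ b) → w.length ≤ C

/-- α is the image of the infinite word β under the (non-erasing) morphism ψ: the image of
every prefix of β is a prefix of α. -/
def IsMorphicImage {B : Type*} (ψ : B → List A) (β : ℕ → B) (α : ℕ → A) : Prop :=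
  ∀ n, factorAt α 0 (((factorAt β 0 n).flatMap ψ).length) = (factorAt β 0 n).flatMap ψ

section Factors

variable {B : Type*}

@[simp] lemma length_factorAt (α : ℕ → A) (i n : ℕ) : (factorAt α i n).length = n := by
  simp [factorAt]

lemma factorAt_eq_iff (α : ℕ → A) (i j n : ℕ) :
    factorAt α i n = factorAt α j n ↔ ∀ m < n, α (i + m) = α (j + m) := by
  simp [factorAt]

lemma factorAt_add (α : ℕ → A) (i m n : ℕ) :
    factorAt α i (m + n) = factorAt α i m ++ factorAt α (i + m) n := by
  simp [factorAt, List.range_add, Function.comp_def, add_assoc]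

lemma factorAt_one (α : ℕ → A) (i : ℕ) : factorAt α i 1 = [α i] := by
  simp [factorAt]

lemma factorAt_succ (α : ℕ → A) (i n : ℕ) :
    factorAt α i (n + 1) = α i :: factorAt α (i + 1) n := by
  rw [add_comm, factorAt_add, factorAt_one, List.singleton_append]

lemma map_factorAt (f : A → B) (α : ℕ → A) (i n : ℕ) :
    (factorAt α i n).map f = factorAt (f ∘ α) i n := by
  simp [factorAt]

lemma isFactor_factorAt (α : ℕ → A) (i n : ℕ) : IsFactor α (factorAt α i n) :=
  ⟨i, by simp⟩

lemma factorSet_eq_range (α : ℕ → A) (n : ℕ) :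
    {w : List A | w.length = n ∧ IsFactor α w} = Set.range fun i => factorAt α i n := by
  ext w
  constructor
  · rintro ⟨rfl, i, hi⟩
    exact ⟨i, hi.symm⟩
  · rintro ⟨i, rfl⟩
    exact ⟨length_factorAt α i n, isFactor_factorAt α i n⟩

lemma complexity_eq_ncard_range (α : ℕ → A) (n : ℕ) :
    complexity α n = (Set.range fun i => factorAt α i n).ncard := by
  rw [complexity, factorSet_eq_range]

lemma finite_range_factorAt [Finite A] (α : ℕ → A) (n : ℕ) :
    (Set.range fun i => factorAt α i n).Finite :=
  (List.finite_length_eq A n).subset (by rintro _ ⟨i, rfl⟩; simp)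

/-- Letter-to-letter images do not increase the complexity. -/
lemma complexity_comp_le [Finite A] (f : A → B) (α : ℕ → A) (n : ℕ) :
    complexity (f ∘ α) n ≤ complexity α n := by
  rw [complexity_eq_ncard_range, complexity_eq_ncard_range]
  have : (Set.range fun i => factorAt (f ∘ α) i n)
      = List.map f '' (Set.range fun i => factorAt α i n) := by
    rw [← Set.range_comp]
    simp [Function.comp_def, map_factorAt]
  rw [this]
  exact Set.ncard_image_le (finite_range_factorAt α n)

/-- If every factor of `β` is determined by a bounded offset and a factor of `α` that is longer
by a constant, then the complexity of `β` is at most a constant times that of `α`. -/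
lemma complexity_le_mul_of_determined [Finite A] (α : ℕ → A) (β : ℕ → B) (o : ℕ → ℕ) (C D : ℕ)
    (ho : ∀ j, o j ≤ j ∧ o j ≤ C)
    (h : ∀ n j k, o j = o k →
      factorAt α (j - o j) (n + D) = factorAt α (k - o k) (n + D) →
      factorAt β j n = factorAt β k n) (n : ℕ) :
    complexity β n ≤
      ((Set.Iic C).ncard * {w : List A | w.length = D}.ncard) * complexity α n := by
  rw [complexity_eq_ncard_range, complexity_eq_ncard_range, ← Set.ncard_prod, ← Set.ncard_prod]
  have hfin : ((Set.Iic C ×ˢ {w : List A | w.length = D}) ×ˢ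
      (Set.range fun i => factorAt α i n)).Finite :=
    ((Set.finite_Iic C).prod (List.finite_length_eq A D)).prod (finite_range_factorAt α n)
  have hex : ∀ w ∈ Set.range (fun i => factorAt β i n), ∃ j, factorAt β j n = w := fun _ hw => hw
  choose! pos hpos using hex
  refine Set.ncard_le_ncard_of_injOn
    (fun w => ((o (pos w), factorAt α (pos w - o (pos w) + n) D),
      factorAt α (pos w - o (pos w)) n)) ?_ ?_ hfin
  · intro w _
    exact ⟨⟨(ho _).2, length_factorAt _ _ _⟩, ⟨_, rfl⟩⟩
  · intro w hw w' hw' heq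
    simp only [Prod.mk.injEq] at heq
    obtain ⟨⟨h₁, h₂⟩, h₃⟩ := heq
    rw [← hpos w hw, ← hpos w' hw']
    exact h n _ _ h₁ (by rw [factorAt_add, factorAt_add, h₂, h₃])

end Factors

section Morphisms

lemma wordMap_append (φ : A → List A) (u v : List A) :
    wordMap φ (u ++ v) = wordMap φ u ++ wordMap φ v := by
  simp [wordMap]

lemma wordMap_iterate_append (φ : A → List A) (n : ℕ) (u v : List A) :
    (wordMap φ)^[n] (u ++ v) = (wordMap φ)^[n] u ++ (wordMap φ)^[n] v := by
  induction n generalizing u v with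
  | zero => rfl
  | succ n ih => simp only [Function.iterate_succ_apply, wordMap_append, ih]

/-- The iterates of the morphism map prefixes of the fixed sequence to prefixes. -/
lemma IsFixedSeq.factorAt_wordMap_iterate {φ : A → List A} {a : A} {α : ℕ → A}
    (hfix : IsFixedSeq φ a α) (hpro : Prolongable φ a) (p j : ℕ) :
    factorAt α 0 ((wordMap φ)^[p] (factorAt α 0 j)).length
      = (wordMap φ)^[p] (factorAt α 0 j) := by
  obtain ⟨n, hn⟩ := (hpro.2.eventually_ge_atTop j).exists
  obtain ⟨d, hd⟩ := Nat.exists_eq_add_of_le hn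
  have h₁ := hfix n
  have h₂ := hfix (p + n)
  rw [Function.iterate_add_apply, ← h₁, hd, factorAt_add, wordMap_iterate_append,
    List.length_append, factorAt_add] at h₂
  exact (List.append_inj h₂ (by simp)).1

/-- An iterate of `φ` acts on the fixed sequence as a position map `L`: the letter at `j` is sent
to the factor between `L j` and `L (j + 1)`. -/
lemma IsFixedSeq.exists_position_map {φ : A → List A} {a : A} {α : ℕ → A}
    (hfix : IsFixedSeq φ a α) (hpro : Prolongable φ a) (p : ℕ) :
    ∃ L : ℕ → ℕ, L 0 = 0 ∧ ∀ j, L (j + 1) = L j + ((wordMap φ)^[p] [α j]).length ∧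
      factorAt α (L j) ((wordMap φ)^[p] [α j]).length = (wordMap φ)^[p] [α j] := by
  refine ⟨fun j => ((wordMap φ)^[p] (factorAt α 0 j)).length, ?_, fun j => ?_⟩
  · have : (wordMap φ)^[p] [] = [] := Function.iterate_fixed rfl p
    simp [factorAt, this]
  · have hs : (wordMap φ)^[p] (factorAt α 0 (j + 1))
        = (wordMap φ)^[p] (factorAt α 0 j) ++ (wordMap φ)^[p] [α j] := by
      rw [factorAt_add, wordMap_iterate_append, factorAt_one, zero_add]
    have h := hfix.factorAt_wordMap_iterate hpro p (j + 1)
    rw [hs, List.length_append, factorAt_add, zero_add] at h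
    exact ⟨by simp only [hs, List.length_append], (List.append_inj h (by simp)).2⟩

/-- Equal factors have equal images under a position map. -/
lemma position_map_congr {α : ℕ → A} {L : ℕ → ℕ} {D : A → List A}
    (hL : ∀ j, L (j + 1) = L j + (D (α j)).length ∧
      factorAt α (L j) (D (α j)).length = D (α j))
    {u v m : ℕ} (h : ∀ i < m, α (u + i) = α (v + i)) :
    ∃ d, L (u + m) = L u + d ∧ L (v + m) = L v + d ∧
      factorAt α (L u) d = factorAt α (L v) d := by
  induction m with
  | zero => exact ⟨0, rfl, rfl, rfl⟩
  | succ m ih =>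
    obtain ⟨d, hu, hv, hd⟩ := ih fun i hi => h i (by omega)
    have hm := h m (by omega)
    refine ⟨d + (D (α (u + m))).length, ?_, ?_, ?_⟩
    · rw [← add_assoc, (hL _).1, hu, add_assoc]
    · rw [← add_assoc, (hL _).1, hv, add_assoc, hm]
    · have h₁ := (hL (u + m)).2
      have h₂ := (hL (v + m)).2
      rw [hu] at h₁
      rw [hv, ← hm] at h₂
      rw [factorAt_add, factorAt_add, hd, h₁, h₂]

end Morphisms

section Substitution

variable {B : Type*} {γ : ℕ → B} {T : ℕ → ℕ} {θ : B → List B}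

lemma add_two_mul_le_of_step (hT : ∀ j, T j + 2 ≤ T (j + 1)) (i d : ℕ) :
    T i + 2 * d ≤ T (i + d) := by
  induction d with
  | zero => simp
  | succ d ih => have := hT (i + d); rw [← add_assoc]; omega

lemma wordMap_factorAt_of_step (hT : ∀ j, T j + 2 ≤ T (j + 1))
    (hθ : ∀ j, θ (γ j) = factorAt γ (T j) (T (j + 1) - T j)) (i n : ℕ) :
    wordMap θ (factorAt γ i n) = factorAt γ (T i) (T (i + n) - T i) := by
  induction n with
  | zero => simp [factorAt, wordMap]
  | succ n ih =>
    have h₁ := add_two_mul_le_of_step hT i n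
    have h₂ := hT (i + n)
    rw [factorAt_add, wordMap_append, ih, factorAt_one]
    have : T (i + (n + 1)) - T i = (T (i + n) - T i) + (T (i + n + 1) - T (i + n)) := by
      rw [← add_assoc]; omega
    rw [this, factorAt_add, show T i + (T (i + n) - T i) = T (i + n) by omega, ← hθ]
    simp [wordMap]

lemma wordMap_iterate_singleton_of_step (hT : ∀ j, T j + 2 ≤ T (j + 1))
    (hθ : ∀ j, θ (γ j) = factorAt γ (T j) (T (j + 1) - T j)) (n j : ℕ) :
    ∃ d, n < d ∧ (wordMap θ)^[n] [γ j] = factorAt γ (T^[n] j) d := by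
  induction n with
  | zero => exact ⟨1, one_pos, (factorAt_one _ _).symm⟩
  | succ n ih =>
    obtain ⟨d, hd, h⟩ := ih
    have := add_two_mul_le_of_step hT (T^[n] j) d
    refine ⟨T (T^[n] j + d) - T (T^[n] j), by omega, ?_⟩
    rw [Function.iterate_succ_apply', Function.iterate_succ_apply', h,
      wordMap_factorAt_of_step hT hθ]

/-- A sequence over a finite alphabet that is compatible with an expanding position map is
generated by a growing morphism. -/
lemma exists_growing_morphism (hγ : Function.Surjective γ) (hT0 : T 0 = 0)
    (hT : ∀ j, T j + 2 ≤ T (j + 1))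
    (hcomp : ∀ j k, γ j = γ k →
      factorAt γ (T j) (T (j + 1) - T j) = factorAt γ (T k) (T (k + 1) - T k)) :
    ∃ θ : B → List B, Growing θ ∧ Prolongable θ (γ 0) ∧ IsFixedSeq θ (γ 0) γ := by
  choose pos hpos using hγ
  let θ : B → List B := fun c => factorAt γ (T (pos c)) (T (pos c + 1) - T (pos c))
  have hθ : ∀ j, θ (γ j) = factorAt γ (T j) (T (j + 1) - T j) := fun j =>
    hcomp _ _ (hpos _)
  have hgrow : Growing θ := by
    intro c
    rw [← hpos c]
    refine tendsto_atTop_mono (fun n => ?_) tendsto_id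
    obtain ⟨d, hd, h⟩ := wordMap_iterate_singleton_of_step hT hθ n (pos c)
    rw [h, length_factorAt]
    exact hd.le
  refine ⟨θ, hgrow, ⟨⟨factorAt γ 1 (T 1 - 1), ?_, ?_⟩, hgrow _⟩, fun n => ?_⟩
  · intro h
    have h₁ := congrArg List.length h
    have h₂ := hT 0
    simp only [length_factorAt, List.length_nil, zero_add] at h₁ h₂
    omega
  · have h₂ := hT 0
    rw [hθ, hT0, zero_add, Nat.sub_zero, ← zero_add 1, ← factorAt_succ]
    congr 1
    simp only [zero_add] at h₂ ⊢
    omega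
  · obtain ⟨d, -, h⟩ := wordMap_iterate_singleton_of_step hT hθ n 0
    rw [h, length_factorAt, Function.iterate_fixed hT0]

end Substitution

section Blocks

/-- `g` and `n` are consecutive positions satisfying `P`, and `g ≤ j < n`. -/
structure BlockAt (P : ℕ → Prop) (j g n : ℕ) : Prop where
  le : g ≤ j
  lt : j < n
  left : P g
  right : P n
  between : ∀ i, g < i → i < n → ¬ P i

lemma BlockAt.unique {P : ℕ → Prop} {j g n g' n' : ℕ} (h : BlockAt P j g n)
    (h' : BlockAt P j g' n') : g = g' ∧ n = n' := by
  have := h.le; have := h.lt; have := h'.le; have := h'.lt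
  refine ⟨le_antisymm ?_ ?_, le_antisymm ?_ ?_⟩ <;> by_contra! hlt
  · exact h'.between g hlt (by omega) h.left
  · exact h.between g' hlt (by omega) h'.left
  · exact h.between n' (by omega) hlt h'.right
  · exact h'.between n (by omega) hlt h.right

lemma exists_blockAt {P : ℕ → Prop} {C : ℕ} (h0 : P 0)
    (hgap : ∀ i, ∃ m, i ≤ m ∧ m ≤ i + C ∧ P m) (j : ℕ) :
    ∃ g n, BlockAt P j g n ∧ n ≤ g + C + 1 := by
  classical
  have hex : ∃ m, j + 1 ≤ m ∧ P m := by
    obtain ⟨m, h, -, hm⟩ := hgap (j + 1)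
    exact ⟨m, h, hm⟩
  have hb : BlockAt P j (Nat.findGreatest P j) (Nat.find hex) := by
    refine ⟨Nat.findGreatest_le j, (Nat.find_spec hex).1,
      Nat.findGreatest_spec (Nat.zero_le j) h0, (Nat.find_spec hex).2, fun i hi hi' hP => ?_⟩
    by_cases hij : i ≤ j
    · exact Nat.findGreatest_is_greatest hi hij hP
    · exact Nat.find_min hex hi' ⟨by omega, hP⟩
  refine ⟨_, _, hb, ?_⟩
  obtain ⟨m, h₁, h₂, h₃⟩ := hgap (Nat.findGreatest P j + 1)
  by_contra! hlt
  exact hb.between m (by omega) (by omega) h₃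

lemma exists_first {P : ℕ → Prop} {C : ℕ} (hgap : ∀ i, ∃ m, i ≤ m ∧ m ≤ i + C ∧ P m) (i : ℕ) :
    ∃ m, i ≤ m ∧ m ≤ i + C ∧ P m ∧ ∀ l, i ≤ l → l < m → ¬ P l := by
  classical
  have hex : ∃ m, i ≤ m ∧ m ≤ i + C ∧ P m := hgap i
  obtain ⟨h₁, h₂, h₃⟩ := Nat.find_spec hex
  exact ⟨_, h₁, h₂, h₃, fun l hl hl' hP => Nat.find_min hex hl' ⟨hl, by omega, hP⟩⟩

variable {α : ℕ → A} {Q : A → Prop}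

/-- The block structure is the same at corresponding positions of two equal factors, between
positions of letters satisfying `Q`. -/
lemma BlockAt.transport {u v M s x e g n : ℕ} (h : BlockAt (fun i => Q (α i)) (u + x) g n)
    (hM : ∀ i < M, α (u + i) = α (v + i)) (hs : Q (α (u + s))) (he : Q (α (u + e)))
    (hsx : s ≤ x) (hxe : x < e) (heM : e < M) :
    ∃ y z, g = u + y ∧ n = u + z ∧ z ≤ e ∧
      BlockAt (fun i => Q (α i)) (v + x) (v + y) (v + z) := by
  have h₁ := h.le
  have h₂ := h.lt
  have hg : u + s ≤ g := by
    by_contra! hlt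
    exact h.between (u + s) hlt (by omega) hs
  have hn : n ≤ u + e := by
    by_contra! hlt
    exact h.between (u + e) (by omega) hlt he
  obtain ⟨y, rfl⟩ := Nat.exists_eq_add_of_le (show u ≤ g by omega)
  obtain ⟨z, rfl⟩ := Nat.exists_eq_add_of_le (show u ≤ n by omega)
  refine ⟨y, z, rfl, rfl, by omega, by omega, by omega, ?_, ?_, fun i hi hi' => ?_⟩
  · have := h.left
    rwa [hM y (by omega)] at this
  · have := h.right
    rwa [hM z (by omega)] at this
  · obtain ⟨i, rfl⟩ := Nat.exists_eq_add_of_le (show v ≤ i by omega)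
    have := h.between (u + i) (by omega) (by omega)
    rwa [hM i (by omega)] at this

/-- The offset of the position `j` in its block, with the block and the letter after it. -/
def blockCode (α : ℕ → A) (G N : ℕ → ℕ) (j : ℕ) : ℕ × List A :=
  (j - G j, factorAt α (G j) (N j - G j + 1))

variable {G N : ℕ → ℕ}

lemma blockCode_eq_of_factor_eq (hGN : ∀ j, BlockAt (fun i => Q (α i)) j (G j) (N j))
    {u v M s x e : ℕ} (hM : ∀ i < M, α (u + i) = α (v + i)) (hs : Q (α (u + s)))
    (he : Q (α (u + e))) (hsx : s ≤ x) (hxe : x < e) (heM : e < M) :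
    blockCode α G N (u + x) = blockCode α G N (v + x) := by
  obtain ⟨y, z, hy, hz, hze, hb⟩ := (hGN (u + x)).transport hM hs he hsx hxe heM
  obtain ⟨hg, hn⟩ := (hGN (v + x)).unique hb
  have h₁ := hb.le
  have h₂ := hb.lt
  rw [blockCode, blockCode, hg, hn, hy, hz]
  simp only [Nat.add_sub_add_left, Prod.mk.injEq, true_and]
  rw [factorAt_eq_iff]
  intro i hi
  rw [add_assoc, add_assoc]
  exact hM _ (by omega)

lemma blockCode_eq_iff {j k : ℕ} : blockCode α G N j = blockCode α G N k ↔
    j - G j = k - G k ∧ N j - G j = N k - G k ∧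
      ∀ i < N j - G j + 1, α (G j + i) = α (G k + i) := by
  constructor
  · intro h
    obtain ⟨h₁, h₂⟩ := Prod.mk.inj h
    have h₃ := congrArg List.length h₂
    simp only [length_factorAt, Nat.add_right_cancel_iff] at h₃
    rw [← h₃, factorAt_eq_iff] at h₂
    exact ⟨h₁, h₃, h₂⟩
  · rintro ⟨h₁, h₂, h₃⟩
    rw [blockCode, blockCode, h₁, ← h₂, (factorAt_eq_iff _ _ _ _).2 h₃]

lemma finite_range_blockCode [Finite A] {C : ℕ}
    (hGN : ∀ j, BlockAt (fun i => Q (α i)) j (G j) (N j)) (hC : ∀ j, N j ≤ G j + C + 1) :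
    (Set.range (blockCode α G N)).Finite := by
  refine ((Set.finite_Iic C).prod (List.finite_length_le A (C + 2))).subset ?_
  rintro _ ⟨j, rfl⟩
  have h₁ := (hGN j).lt
  have h₂ := hC j
  refine ⟨?_, ?_⟩
  · simp only [blockCode, Set.mem_Iic]; omega
  · simp only [blockCode, Set.mem_ofPred_eq, length_factorAt]; omega

lemma eq_of_blockCode_eq (hGN : ∀ j, BlockAt (fun i => Q (α i)) j (G j) (N j)) {j k : ℕ}
    (h : blockCode α G N j = blockCode α G N k) : α j = α k := by
  obtain ⟨h₁, -, h₃⟩ := blockCode_eq_iff.1 h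
  have := (hGN j).le
  have := (hGN j).lt
  have := (hGN k).le
  have h₄ := h₃ (j - G j) (by omega)
  rwa [show G j + (j - G j) = j by omega, show G k + (j - G j) = k by omega] at h₄

/-- The block codes admit an expanding position map. -/
lemma exists_expanding_map {C : ℕ} {D : A → List A} {L : ℕ → ℕ}
    (hgap : ∀ i, ∃ m, i ≤ m ∧ m ≤ i + C ∧ Q (α m)) (h0 : Q (α 0)) (hL0 : L 0 = 0)
    (hL : ∀ j, L (j + 1) = L j + (D (α j)).length ∧
      factorAt α (L j) (D (α j)).length = D (α j))
    (hD : ∀ c, Q c → 3 * C + 2 ≤ (D c).length)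
    (hGN : ∀ j, BlockAt (fun i => Q (α i)) j (G j) (N j)) (hC : ∀ j, N j ≤ G j + C + 1) :
    ∃ T : ℕ → ℕ, T 0 = 0 ∧ (∀ j, T j + 2 ≤ T (j + 1)) ∧
      ∀ j k, blockCode α G N j = blockCode α G N k → T (j + 1) - T j = T (k + 1) - T k ∧
        ∀ i < T (j + 1) - T j, blockCode α G N (T j + i) = blockCode α G N (T k + i) := by
  choose F hFge hFle hFQ hFmin using exists_first (P := fun i => Q (α i)) hgap
  have hmono : Monotone L := monotone_nat_of_le_succ fun j => by rw [(hL j).1]; omega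
  have hlen : ∀ j, Q (α j) → L j + (3 * C + 2) ≤ L (j + 1) := fun j hj => by
    rw [(hL j).1]; have := hD _ hj; omega
  have hnext : ∀ j, j + 1 < N j → G (j + 1) = G j := fun j hj =>
    ((hGN (j + 1)).unique ⟨by have := (hGN j).le; omega, hj, (hGN j).left, (hGN j).right,
      (hGN j).between⟩).1
  have hlast : ∀ j, j + 1 = N j → G (j + 1) = N j := fun j hj => by
    by_contra hne
    have h₁ := (hGN (j + 1)).le
    have h₂ := (hGN (j + 1)).lt
    exact (hGN (j + 1)).between (N j) (by omega) (by omega) (hGN j).right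
  have hgapF : ∀ j, F (L (G j)) + (2 * C + 2) ≤ F (L (N j)) := fun j => by
    have h₁ := hFle (L (G j))
    have h₂ := hFge (L (N j))
    have h₃ := hlen (G j) (hGN j).left
    have h₄ : L (G j + 1) ≤ L (N j) := hmono (by have := (hGN j).le; have := (hGN j).lt; omega)
    omega
  have hFcongr : ∀ u v d x, factorAt α u d = factorAt α v d → x + C < d →
      ∃ y, F (u + x) = u + y ∧ F (v + x) = v + y ∧ y < d := by
    intro u v d x hd hx
    rw [factorAt_eq_iff] at hd
    have h₁ := hFge (u + x)
    have h₂ := hFle (u + x)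
    have h₃ := hFge (v + x)
    have h₄ := hFle (v + x)
    obtain ⟨y, hy⟩ := Nat.exists_eq_add_of_le (show u ≤ F (u + x) by omega)
    obtain ⟨z, hz⟩ := Nat.exists_eq_add_of_le (show v ≤ F (v + x) by omega)
    have hQy := hFQ (u + x)
    have hQz := hFQ (v + x)
    simp only [hy, hz] at hQy hQz
    have hyz : y = z := by
      refine le_antisymm ?_ ?_ <;> by_contra! hlt
      · rw [← hd z (by omega)] at hQz
        exact hFmin (u + x) (u + z) (by omega) (by omega) hQz
      · rw [hd y (by omega)] at hQy
        exact hFmin (v + x) (v + y) (by omega) (by omega) hQy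
    exact ⟨y, hy, hyz ▸ hz, by omega⟩
  have hG0 : G 0 = 0 := Nat.le_zero.1 (hGN 0).le
  have hF0 : F 0 = 0 := by
    by_contra hne
    exact hFmin 0 0 le_rfl (Nat.pos_of_ne_zero hne) h0
  refine ⟨fun j => F (L (G j)) + 2 * (j - G j), ?_, fun j => ?_, fun j k hjk => ?_⟩
  · simp [hG0, hL0, hF0]
  · have h₁ := (hGN j).le
    have h₂ := (hGN j).lt
    have h₃ := hC j
    have h₄ := hgapF j
    rcases (show j + 1 ≤ N j from h₂).lt_or_eq with h | h
    · simp only [hnext j h]; omega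
    · simp only [hlast j h]; omega
  · obtain ⟨ho, hm, hα⟩ := blockCode_eq_iff.1 hjk
    have hj₁ := (hGN j).le
    have hj₂ := (hGN j).lt
    have hk₁ := (hGN k).le
    have hk₂ := (hGN k).lt
    have hjC := hC j
    obtain ⟨d, hdj, hdk, hd⟩ := position_map_congr hL hα
    obtain ⟨c, hcj, hck, -⟩ := position_map_congr hL
      (m := N j - G j) (fun i hi => hα i (by omega))
    rw [show G j + (N j - G j) = N j by omega] at hcj
    rw [show G k + (N j - G j) = N k by omega] at hck
    have hcd : c + (3 * C + 2) ≤ d := by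
      have := hlen (N j) (hGN j).right
      rw [show G j + (N j - G j + 1) = N j + 1 by omega] at hdj
      omega
    obtain ⟨s, hsj, hsk, -⟩ := hFcongr (L (G j)) (L (G k)) d 0 hd (by omega)
    obtain ⟨e, hej, hek, hed⟩ := hFcongr (L (G j)) (L (G k)) d c hd (by omega)
    rw [← hcj] at hej
    rw [← hck] at hek
    rw [add_zero] at hsj hsk
    have hse := hgapF j
    have hQs := hFQ (L (G j))
    have hQe := hFQ (L (N j))
    simp only [hsj, hej] at hQs hQe hse
    rw [factorAt_eq_iff] at hd
    have hcode : ∀ x, s ≤ x → x < e →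
        blockCode α G N (L (G j) + x) = blockCode α G N (L (G k) + x) := fun x hx hx' =>
      blockCode_eq_of_factor_eq hGN hd hQs hQe hx hx' hed
    rcases (show j + 1 ≤ N j from hj₂).lt_or_eq with h | h
    · simp only [hnext j h, hnext k (by omega), hsj, hsk]
      refine ⟨by omega, fun i hi => ?_⟩
      have := hcode (s + 2 * (j - G j) + i) (by omega) (by omega)
      rw [← ho]
      simpa only [add_assoc] using this
    · have h' : k + 1 = N k := by omega
      simp only [hlast j h, hlast k h', hsj, hsk, hej, hek]
      refine ⟨by omega, fun i hi => ?_⟩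
      have := hcode (s + 2 * (j - G j) + i) (by omega) (by omega)
      rw [← ho]
      simpa only [add_assoc] using this

/-- A factor of the sequence of block codes is determined by a slightly longer factor of `α`. -/
lemma factorAt_blockCode_determined {C : ℕ}
    (hGN : ∀ j, BlockAt (fun i => Q (α i)) j (G j) (N j)) (hC : ∀ j, N j ≤ G j + C + 1)
    (n j k : ℕ) (ho : j - G j = k - G k)
    (h : factorAt α (G j) (n + (2 * C + 2)) = factorAt α (G k) (n + (2 * C + 2))) :
    factorAt (blockCode α G N) j n = factorAt (blockCode α G N) k n := by
  rw [factorAt_eq_iff] at h ⊢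
  intro i hi
  have hj₁ := (hGN j).le
  have hj₂ := (hGN j).lt
  have hjC := hC j
  have hk₁ := (hGN k).le
  have h₁ := (hGN (j + i)).lt
  have h₂ := (hGN (j + i)).le
  have h₃ := hC (j + i)
  have key := blockCode_eq_of_factor_eq hGN (x := j - G j + i) (s := 0)
    (e := N (j + i) - G j) h (hGN j).left
    (by rw [show G j + (N (j + i) - G j) = N (j + i) by omega]; exact (hGN (j + i)).right)
    (by omega) (by omega) (by omega)
  rwa [show G j + (j - G j + i) = j + i by omega,
    show G k + (j - G j + i) = k + i by omega] at key

end Blocks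

lemma BFactorsBounded.exists_growing {φ : A → List A} {α : ℕ → A} {C : ℕ}
    (hC : ∀ w : List A, IsFactor α w → (∀ b ∈ w, BoundedLetter φ b) → w.length ≤ C) (i : ℕ) :
    ∃ m, i ≤ m ∧ m ≤ i + C ∧ GrowingLetter φ (α m) := by
  by_contra! hne
  have := hC (factorAt α i (C + 1)) (isFactor_factorAt _ _ _) (by
    simp only [factorAt, List.mem_map, List.mem_range]
    rintro _ ⟨m, hm, rfl⟩
    exact hne _ (by omega) (by omega))
  rw [length_factorAt] at this
  omega

/-- If φ is not growing and the factors of α in B* have bounded length, then α is the image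
under a non-erasing morphism of a pure morphic sequence of a growing morphism, with the same
complexity class. -/
theorem nonGrowing_bounded_reduction {A : Type*} [Fintype A] (φ : A → List A) (a : A)
    (α : ℕ → A) (hng : ¬ Growing φ) (hpro : Prolongable φ a) (hfix : IsFixedSeq φ a α)
    (hb : BFactorsBounded φ α) :
    ∃ (s : ℕ) (σ : Fin s → List (Fin s)) (b : Fin s) (ψ : Fin s → List A) (β : ℕ → Fin s),
      Growing σ ∧ Prolongable σ b ∧ IsFixedSeq σ b β ∧ (∀ c, ψ c ≠ []) ∧
      IsMorphicImage ψ β α ∧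
      (fun n => (complexity α n : ℝ)) =Θ[atTop] (fun n => (complexity β n : ℝ)) := by
  obtain ⟨C, hC⟩ := hb
  have hgap := BFactorsBounded.exists_growing hC
  have h0 : GrowingLetter φ (α 0) := by
    have h : α 0 = a := by simpa [factorAt] using hfix 0
    rw [h]
    exact hpro.2
  obtain ⟨p, hp⟩ : ∃ p, ∀ c, GrowingLetter φ c →
      3 * C + 2 ≤ ((wordMap φ)^[p] [c]).length := by
    have : ∀ᶠ p in atTop, ∀ c, GrowingLetter φ c →
        3 * C + 2 ≤ ((wordMap φ)^[p] [c]).length := by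
      rw [eventually_all]
      intro c
      by_cases hc : GrowingLetter φ c
      · filter_upwards [hc.eventually_ge_atTop (3 * C + 2)] with p hp _ using hp
      · exact Eventually.of_forall fun _ h => absurd h hc
    exact this.exists
  choose G N hGN hGNC using exists_blockAt (P := fun i => GrowingLetter φ (α i)) h0 hgap
  obtain ⟨L, hL0, hL⟩ := hfix.exists_position_map hpro p
  obtain ⟨T, hT0, hT, hTcode⟩ := exists_expanding_map hgap h0 hL0 (D := fun c =>
    (wordMap φ)^[p] [c]) hL hp hGN hGNC
  have : Finite (Set.range (blockCode α G N)) := finite_range_blockCode hGN hGNC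
  obtain ⟨s, ⟨E⟩⟩ := Finite.exists_equiv_fin (Set.range (blockCode α G N))
  let β : ℕ → Fin s := fun j => E (Set.rangeFactorization (blockCode α G N) j)
  have hβ : ∀ j k, β j = β k ↔ blockCode α G N j = blockCode α G N k := fun j k => by
    simp only [β, E.injective.eq_iff, Set.rangeFactorization, Subtype.mk.injEq]
  have hsurj : Function.Surjective β :=
    E.surjective.comp Set.rangeFactorization_surjective
  obtain ⟨θ, hgrow, hθpro, hθfix⟩ := exists_growing_morphism hsurj hT0 hT (by
    intro j k hjk
    obtain ⟨h₁, h₂⟩ := hTcode j k ((hβ j k).1 hjk)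
    rw [← h₁, factorAt_eq_iff]
    exact fun i hi => (hβ _ _).2 (h₂ i hi))
  let f : Fin s → A := fun c => α (Function.surjInv hsurj c)
  have hf : f ∘ β = α := funext fun j =>
    eq_of_blockCode_eq hGN ((hβ _ _).1 (Function.surjInv_eq hsurj (β j)))
  refine ⟨s, θ, β 0, fun c => [f c], β, hgrow, hθpro, hθfix, fun c => List.cons_ne_nil _ _,
    fun n => ?_, ?_⟩
  · rw [← List.map_eq_flatMap, map_factorAt, hf, length_factorAt]
  · refine ⟨?_, ?_⟩
    · refine IsBigO.of_bound 1 (Eventually.of_forall fun n => ?_)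
      rw [one_mul, Real.norm_natCast, Real.norm_natCast, Nat.cast_le]
      have := complexity_comp_le f β n
      rwa [hf] at this
    · have hle := complexity_le_mul_of_determined α β (fun j => j - G j) C (2 * C + 2)
        (fun j => ⟨Nat.sub_le _ _, by
          have := (hGN j).lt
          have := hGNC j
          omega⟩)
        (fun n j k ho h => by
          have := (hGN j).le
          have := (hGN k).le
          simp only [show j - (j - G j) = G j by omega,
            show k - (k - G k) = G k by omega] at h
          have h' := factorAt_blockCode_determined hGN hGNC n j k ho h
          rw [factorAt_eq_iff] at h' ⊢
          exact fun i hi => (hβ _ _).2 (h' i hi))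
      refine IsBigO.of_bound
        (((Set.Iic C).ncard * {w : List A | w.length = 2 * C + 2}.ncard : ℕ) : ℝ)
        (Eventually.of_forall fun n => ?_)
      rw [Real.norm_natCast, Real.norm_natCast]
      exact_mod_cast hle n
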